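/- arXiv:1511.05535 — 2 statements merged into one kernel-verified Lean document; each statement's English description precedes it below -/
import Mathlib

section
/- Column balance and domination for matchings (Proposition prop:main, parts 2 and 3): Let G = G_{p,k} be the graph with open faces associated with p and an admissible stepped surface k (with k₀ ≥ k(i₀,j₀) and k ≥ fund), and let M be a perfect matching of G. Then for each i ∈ ℤ the number of black-white horizontal edges S(i,·) of M in column i equals the number of white-black horizontal edges N(i,·) of M in column i; moreover, for each i,j ∈ ℤ, #{ S(i,b) ∈ M : b ≤ j } ≥ #{ N(i,b) ∈ M : b ≤ j }, i.e. reading each column from bottom to top the black-white horizontal edges of M dominate the white-black ones. -/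
noncomputable section
open Classical

namespace OctahedronTSystem

/-- A stepped surface: a height function on `ℤ × ℤ` changing by exactly `1`
between lattice-adjacent points. -/
def SteppedSurface (k : ℤ × ℤ → ℤ) : Prop :=
  ∀ a b : ℤ × ℤ, |a.1 - b.1| + |a.2 - b.2| = 1 → |k a - k b| = 1

/-- The fundamental stepped surface `fund(i,j) = ((i+j) mod 2) - 1`. -/
def fund : ℤ × ℤ → ℤ := fun v => (v.1 + v.2) % 2 - 1

/-- Index type for the independent variables: `t(i,j)` on the left, `c(i,j)` on the right. -/
abbrev Var : Type := (ℤ × ℤ) ⊕ (ℤ × ℤ)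

/-- The ambient field of rational functions over `ℚ` in the independent variables
`t(i,j)` and `c(i,j)`, `(i,j) ∈ ℤ × ℤ`. -/
abbrev F : Type := FractionRing (MvPolynomial Var ℚ)

/-- The variable `t(i,j)` as an element of the ambient field. -/
def tv (v : ℤ × ℤ) : F := algebraMap (MvPolynomial Var ℚ) F (MvPolynomial.X (Sum.inl v))

/-- The variable `c(i,j)` as an element of the ambient field. -/
def cv (v : ℤ × ℤ) : F := algebraMap (MvPolynomial Var ℚ) F (MvPolynomial.X (Sum.inr v))

/-- `I(i,j,m) = ∏_{a=m+1}^{-m-1} c(i+a,j)` if `m < 0` and `1` otherwise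
(the interval `[m+1, -m-1]` is empty when `m ≥ 0`). -/
def coefI {C : Type*} [CommMonoid C] (c : ℤ × ℤ → C) (i j m : ℤ) : C :=
  ∏ a ∈ Finset.Icc (m + 1) (-m - 1), c (i + a, j)

/-- `J(i,j,m) = ∏_{a=-m}^{m} c(i,j+a)` if `m ≥ 0` and `1` otherwise
(the interval `[-m, m]` is empty when `m < 0`). -/
def coefJ {C : Type*} [CommMonoid C] (c : ℤ × ℤ → C) (i j m : ℤ) : C :=
  ∏ a ∈ Finset.Icc (-m) m, c (i, j + a)

/-- Edges of the bipartite graph `G_k` (the planar dual of the quiver `Q_k`), indexed by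
the arrow of `Q_k` they cross:
* `h i j` : the horizontal edge dual to the vertical lattice edge from `(i,j)` to `(i,j+1)`
  (the face `(i,j)` lies directly below it, the face `(i,j+1)` directly above it);
* `v i j` : the vertical edge dual to the horizontal lattice edge from `(i,j)` to `(i+1,j)`;
* `d i j` : the diagonal edge inside the unit square with lower-left corner `(i,j)`
  (present exactly when that square carries a diagonal arrow). -/
inductive Edge : Type
  | h : ℤ → ℤ → Edge
  | v : ℤ → ℤ → Edge
  | d : ℤ → ℤ → Edge
  deriving DecidableEq

/-- A vertex of `G_k`: a (square or triangular) face of the quiver `Q_k`, recorded as the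
unit square (lower-left corner) containing it together with a Boolean: `false` for the
part containing the bottom side of the square, `true` for the part containing the top
side (used only when the square is split by a diagonal). -/
abbrev Vtx : Type := (ℤ × ℤ) × Bool

namespace Edge

/-- The part of the square `s` touching its west side. -/
def tAD (k : ℤ × ℤ → ℤ) (s : ℤ × ℤ) : Bool := decide (k (s.1 + 1, s.2) ≠ k (s.1, s.2 + 1))

/-- The part of the square `s` touching its east side. -/
def tBC (k : ℤ × ℤ → ℤ) (s : ℤ × ℤ) : Bool := decide (k s ≠ k (s.1 + 1, s.2 + 1))

/-- Endpoints of an edge: `(left, right)` for horizontal and diagonal edges,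
`(bottom, top)` for vertical ones. -/
def ends (k : ℤ × ℤ → ℤ) : Edge → Vtx × Vtx
  | h i j => (((i - 1, j), tBC k (i - 1, j)), ((i, j), tAD k (i, j)))
  | v i j => (((i, j - 1), tAD k (i, j - 1) || tBC k (i, j - 1)), ((i, j), false))
  | d i j => (((i, j), tAD k (i, j)), ((i, j), tBC k (i, j)))

/-- `x` is an endpoint of the edge `e`. -/
def mem (k : ℤ × ℤ → ℤ) (x : Vtx) (e : Edge) : Prop :=
  x = (ends k e).1 ∨ x = (ends k e).2

/-- The edge is present in the graph `G_k` (diagonal edges exist only in squares split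
by a diagonal arrow of the quiver). -/
def valid (k : ℤ × ℤ → ℤ) : Edge → Prop
  | h _ _ => True
  | v _ _ => True
  | d i j => k (i, j) ≠ k (i + 1, j + 1) ∨ k (i + 1, j) ≠ k (i, j + 1)

/-- The edge `e` is a side of the face `f` of `G_k` (faces are indexed by the quiver
vertices `(i,j) ∈ ℤ × ℤ`; an edge is a side of the two faces corresponding to the two
endpoints of the arrow it crosses). -/
def isSide (k : ℤ × ℤ → ℤ) (f : ℤ × ℤ) : Edge → Prop
  | h i j => f = (i, j) ∨ f = (i, j + 1)
  | v i j => f = (i, j) ∨ f = (i + 1, j)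
  | d i j => if tAD k (i, j) then f = (i, j) ∨ f = (i + 1, j + 1)
             else f = (i + 1, j) ∨ f = (i, j + 1)

def isHoriz : Edge → Prop
  | h _ _ => True
  | _ => False

def isVert : Edge → Prop
  | v _ _ => True
  | _ => False

def isDiag : Edge → Prop
  | d _ _ => True
  | _ => False

end Edge

/-- A vertex is white when the arrows around the corresponding face of `Q_k` run
counterclockwise and black when they run clockwise. -/
def isWhite (k : ℤ × ℤ → ℤ) (x : Vtx) : Bool :=
  decide (k (x.1.1 + 1, x.1.2) < k x.1) != x.2

/-- Source of an oriented edge: horizontal and diagonal edges are oriented from left to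
right, vertical edges from their black endpoint to their white endpoint. -/
def Edge.src (k : ℤ × ℤ → ℤ) (e : Edge) : Vtx :=
  match e with
  | Edge.v _ _ =>
      if isWhite k (Edge.ends k e).1 then (Edge.ends k e).2 else (Edge.ends k e).1
  | _ => (Edge.ends k e).1

/-- Target of an oriented edge. -/
def Edge.dst (k : ℤ × ℤ → ℤ) (e : Edge) : Vtx :=
  match e with
  | Edge.v _ _ =>
      if isWhite k (Edge.ends k e).1 then (Edge.ends k e).1 else (Edge.ends k e).2
  | _ => (Edge.ends k e).2

/-- The set `F̊` of closed faces. -/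
def innerF (i₀ j₀ k₀ : ℤ) (k : ℤ × ℤ → ℤ) : Set (ℤ × ℤ) :=
  {f | |f.1 - i₀| + |f.2 - j₀| < k₀ - k f}

/-- The set `∂F` of open faces. -/
def bdryF (i₀ j₀ k₀ : ℤ) (k : ℤ × ℤ → ℤ) : Set (ℤ × ℤ) :=
  if k₀ = k (i₀, j₀) then {(i₀, j₀)}
  else {f | f ∉ innerF i₀ j₀ k₀ k ∧ ∃ g ∈ innerF i₀ j₀ k₀ k, |f.1 - g.1| + |f.2 - g.2| = 1}

/-- The set `F̊ ∪ ∂F` of all faces of the closure. -/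
def allF (i₀ j₀ k₀ : ℤ) (k : ℤ × ℤ → ℤ) : Set (ℤ × ℤ) :=
  innerF i₀ j₀ k₀ k ∪ bdryF i₀ j₀ k₀ k

/-- The edge set of the graph with open faces `G = G_{p,k}`: the finite subgraph of `G_k`
generated by the faces in `F̊`. -/
def EG (i₀ j₀ k₀ : ℤ) (k : ℤ × ℤ → ℤ) : Set Edge :=
  {e | e.valid k ∧ ∃ f ∈ innerF i₀ j₀ k₀ k, e.isSide k f}

/-- The adjusted stepped surface `k_p(i,j) = min (k(i,j), k₀ - |i-i₀| - |j-j₀|)`. -/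
def kAdj (i₀ j₀ k₀ : ℤ) (k : ℤ × ℤ → ℤ) : ℤ × ℤ → ℤ :=
  fun f => min (k f) (k₀ - |f.1 - i₀| - |f.2 - j₀|)

/-- The edge set of the closure `Ḡ` of `G`: the finite subgraph of `G_{k_p}` generated by
the faces in `F̊ ∪ ∂F`. -/
def EGbar (i₀ j₀ k₀ : ℤ) (k : ℤ × ℤ → ℤ) : Set Edge :=
  {e | e.valid (kAdj i₀ j₀ k₀ k) ∧ ∃ f ∈ allF i₀ j₀ k₀ k, e.isSide (kAdj i₀ j₀ k₀ k) f}

/-- The vertex set of the graph with edge set `E`. -/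
def VG (k : ℤ × ℤ → ℤ) (E : Set Edge) : Set Vtx := {x | ∃ e ∈ E, Edge.mem k x e}

/-- A perfect matching of the graph with edge set `E`. -/
def IsPerfectMatching (k : ℤ × ℤ → ℤ) (E M : Set Edge) : Prop :=
  M ⊆ E ∧ ∀ x ∈ VG k E, ∃! e, e ∈ M ∧ Edge.mem k x e

/-- The edge set of the infinite graph `G_∞ = G_{k_p}`. -/
def Einf (i₀ j₀ k₀ : ℤ) (k : ℤ × ℤ → ℤ) : Set Edge := {e | e.valid (kAdj i₀ j₀ k₀ k)}

/-- Acceptable perfect matchings of `G_∞`: perfect matchings `M` of `G_∞` such that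
`M \ E(G)` is exactly the set of all diagonal edges of `E(G_∞) \ E(G)`. -/
def Acceptable (i₀ j₀ k₀ : ℤ) (k : ℤ × ℤ → ℤ) : Set (Set Edge) :=
  {M | IsPerfectMatching (kAdj i₀ j₀ k₀ k) (Einf i₀ j₀ k₀ k) M ∧
       M \ EG i₀ j₀ k₀ k = {e | e ∈ Einf i₀ j₀ k₀ k ∧ e ∉ EG i₀ j₀ k₀ k ∧ e.isDiag}}

/-- The set `Diag(E(Ḡ) \ E(G))` of diagonal edges of the closure not in `G`. -/
def diagExt (i₀ j₀ k₀ : ℤ) (k : ℤ × ℤ → ℤ) : Set Edge :=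
  {e | e ∈ EGbar i₀ j₀ k₀ k ∧ e ∉ EG i₀ j₀ k₀ k ∧ e.isDiag}

/-- `M̄set = { M ∪ Diag(E(Ḡ)\E(G)) : M a perfect matching of G }`. -/
def MbarSet (i₀ j₀ k₀ : ℤ) (k : ℤ × ℤ → ℤ) : Set (Set Edge) :=
  {N | ∃ M, IsPerfectMatching k (EG i₀ j₀ k₀ k) M ∧ N = M ∪ diagExt i₀ j₀ k₀ k}

/-- The set of all white-black horizontal edges (white endpoint on the left) and all
diagonal edges of the graph with edge set `E`; for `E = E(Ḡ)` this is `M̄₀`, for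
`E = E(G)` it is `M₀`. -/
def M0 (k : ℤ × ℤ → ℤ) (E : Set Edge) : Set Edge :=
  {e ∈ E | e.isDiag ∨ (e.isHoriz ∧ isWhite k (Edge.ends k e).1 = true)}

/-- `j ∈ NSet k M i` iff the white-black horizontal edge `N(i,j)` (with face `(i,j)`
directly below it) belongs to `M`. -/
def NSet (k : ℤ × ℤ → ℤ) (M : Set Edge) (i : ℤ) : Set ℤ :=
  {j | Edge.h i j ∈ M ∧ isWhite k (Edge.ends k (Edge.h i j)).1 = true}

/-- `j ∈ SSet k M i` iff the black-white horizontal edge `S(i,j)` (with face `(i,j)`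
directly above it) belongs to `M`. -/
def SSet (k : ℤ × ℤ → ℤ) (M : Set Edge) (i : ℤ) : Set ℤ :=
  {j | Edge.h i (j - 1) ∈ M ∧ isWhite k (Edge.ends k (Edge.h i (j - 1))).1 = false}

/-- A perfect pairing of the horizontal edges of a matching `M`: a set of allowed pairs
`(S(i,j₁), N(i,j₂))`, `j₁ ≤ j₂`, in the same column, using each `S`-edge and each
`N`-edge of `M` exactly once, and noncrossing (this characterises the pairing produced
by the bottom-to-top reading procedure). -/
def IsPerfectPairing (k : ℤ × ℤ → ℤ) (M : Set Edge)
    (P : Set ((ℤ × ℤ) × (ℤ × ℤ))) : Prop :=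
  (∀ q ∈ P, q.1.1 = q.2.1 ∧ q.1.2 ≤ q.2.2 ∧
      q.1.2 ∈ SSet k M q.1.1 ∧ q.2.2 ∈ NSet k M q.2.1) ∧
  (∀ i j : ℤ, j ∈ SSet k M i → ∃! q, q ∈ P ∧ q.1 = (i, j)) ∧
  (∀ i j : ℤ, j ∈ NSet k M i → ∃! q, q ∈ P ∧ q.2 = (i, j)) ∧
  (∀ q ∈ P, ∀ q' ∈ P, q.1.1 = q'.1.1 →
      ¬(q.1.2 < q'.1.2 ∧ q'.1.2 ≤ q.2.2 ∧ q.2.2 < q'.2.2))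

/-- The weight `∏_{a=j₁-k(i,j₁)-1}^{j₂+k(i,j₂)+1} c(i,a)` of an allowed pair
`((i,j₁),(i,j₂))`. -/
def pairWeight (k : ℤ × ℤ → ℤ) (q : (ℤ × ℤ) × (ℤ × ℤ)) : F :=
  ∏ a ∈ Finset.Icc (q.1.2 - k q.1 - 1) (q.2.2 + k q.2 + 1), cv (q.1.1, a)

/-- The pairing-weight: product of the weights of all allowed pairs of a perfect pairing. -/
def wp (k : ℤ × ℤ → ℤ) (P : Set ((ℤ × ℤ) × (ℤ × ℤ))) : F :=
  ∏ᶠ q ∈ P, pairWeight k q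

/-- The sides of the face `f` among the edges `E`. -/
def sides (k : ℤ × ℤ → ℤ) (E : Set Edge) (f : ℤ × ℤ) : Set Edge :=
  {e ∈ E | e.isSide k f}

/-- `⌈(b - a)/2⌉` where `a` (resp. `b`) is the number of sides of the face `f` lying in
(resp. not in) the matching `M`. -/
def faceExp (k : ℤ × ℤ → ℤ) (E M : Set Edge) (f : ℤ × ℤ) : ℤ :=
  ⌈((((sides k E f \ M).ncard : ℚ) - ((sides k E f ∩ M).ncard : ℚ)) / 2 : ℚ)⌉

/-- The face-weight of a matching of the graph with open faces `G`: closed faces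
contribute `t(f)^(⌈(b-a)/2⌉ - 1)` and open faces contribute `t(f)^⌈(b-a)/2⌉`. -/
def wfOpen (i₀ j₀ k₀ : ℤ) (k : ℤ × ℤ → ℤ) (E M : Set Edge) : F :=
  (∏ᶠ f ∈ innerF i₀ j₀ k₀ k, tv f ^ (faceExp k E M f - 1)) *
  (∏ᶠ f ∈ bdryF i₀ j₀ k₀ k, tv f ^ faceExp k E M f)

/-- The face-weight over a set `S` of faces, all of them closed. -/
def wfClosed (k : ℤ × ℤ → ℤ) (E M : Set Edge) (S : Set (ℤ × ℤ)) : F :=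
  ∏ᶠ f ∈ S, tv f ^ (faceExp k E M f - 1)

/-- The `c`-exponent function of an edge (an element of the abelian group of `ℤ`-valued
exponent functions on `ℤ × ℤ`):  a white-black horizontal edge `e = h i j` (face
`b = (i,j)` below it) carries `p̄_b = (∏_{α ≥ j + k(i,j) + 2} c(i,α))⁻¹`; a black-white
horizontal edge `e = h i j` (face `a = (i,j+1)` above it) carries
`p_a = ∏_{α ≥ (j+1) - k(i,j+1) - 1} c(i,α)`; other edges carry no `c`'s.  Colors are read
in the surface `kc`, heights in the surface `kt`. -/
def edgeCExp (kc kt : ℤ × ℤ → ℤ) : Edge → ℤ × ℤ → ℤ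
  | Edge.h i j => fun v =>
      if isWhite kc (Edge.ends kc (Edge.h i j)).1 then
        if v.1 = i ∧ j + kt (i, j) + 2 ≤ v.2 then -1 else 0
      else
        if v.1 = i ∧ j - kt (i, j + 1) ≤ v.2 then 1 else 0
  | _ => fun _ => 0

/-- The `t`-part of the edge-weight: `∏ t(f)⁻¹` over the faces `f ∈ S` incident to `e`. -/
def edgeTPart (k : ℤ × ℤ → ℤ) (S : Set (ℤ × ℤ)) (e : Edge) : F :=
  ∏ᶠ f ∈ {f ∈ S | e.isSide k f}, (tv f)⁻¹

/-- Evaluation of a (finitely supported) exponent function as a Laurent monomial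
in the `c(i,j)`. -/
def evalExp (g : ℤ × ℤ → ℤ) : F := ∏ᶠ v : ℤ × ℤ, cv v ^ g v

/-- Left-most vertices lying south-west of the center face `(i₀,j₀)`. -/
def VleftSW (i₀ j₀ : ℤ) (k : ℤ × ℤ → ℤ) (E : Set Edge) : Set Vtx :=
  {x | x ∈ VG k E ∧ x.1.1 < i₀ ∧ x.1.2 < j₀ ∧
       ¬∃ e ∈ E, (e.isHoriz ∨ e.isDiag) ∧ (Edge.ends k e).2 = x}

/-- Right-most vertices lying south-east of the center face `(i₀,j₀)`. -/
def VrightSE (i₀ j₀ : ℤ) (k : ℤ × ℤ → ℤ) (E : Set Edge) : Set Vtx :=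
  {x | x ∈ VG k E ∧ i₀ ≤ x.1.1 ∧ x.1.2 < j₀ ∧
       ¬∃ e ∈ E, (e.isHoriz ∨ e.isDiag) ∧ (Edge.ends k e).1 = x}

/-- Left-most vertices lying north-west of the center face `(i₀,j₀)`. -/
def VleftNW (i₀ j₀ : ℤ) (k : ℤ × ℤ → ℤ) (E : Set Edge) : Set Vtx :=
  {x | x ∈ VG k E ∧ x.1.1 < i₀ ∧ j₀ ≤ x.1.2 ∧
       ¬∃ e ∈ E, (e.isHoriz ∨ e.isDiag) ∧ (Edge.ends k e).2 = x}

/-- Right-most vertices lying north-east of the center face `(i₀,j₀)`. -/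
def VrightNE (i₀ j₀ : ℤ) (k : ℤ × ℤ → ℤ) (E : Set Edge) : Set Vtx :=
  {x | x ∈ VG k E ∧ i₀ ≤ x.1.1 ∧ j₀ ≤ x.1.2 ∧
       ¬∃ e ∈ E, (e.isHoriz ∨ e.isDiag) ∧ (Edge.ends k e).1 = x}

/-- `P` is the edge set of a family of vertex-disjoint directed paths in the oriented
graph with edge set `E` whose sources are exactly `Src` and whose sinks are exactly
`Snk`. -/
def IsPathFamily (k : ℤ × ℤ → ℤ) (E P : Set Edge) (Src Snk : Set Vtx) : Prop :=
  P ⊆ E ∧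
  (∀ x ∈ Src, ({e ∈ P | Edge.src k e = x}).ncard = 1 ∧ {e ∈ P | Edge.dst k e = x} = ∅) ∧
  (∀ x ∈ Snk, ({e ∈ P | Edge.dst k e = x}).ncard = 1 ∧ {e ∈ P | Edge.src k e = x} = ∅) ∧
  (∀ x : Vtx, x ∉ Src → x ∉ Snk →
      ({e ∈ P | Edge.src k e = x}).ncard = ({e ∈ P | Edge.dst k e = x}).ncard ∧
      ({e ∈ P | Edge.src k e = x}).ncard ≤ 1) ∧
  ∀ x : Vtx, ¬ Relation.TransGen (fun a b => ∃ e ∈ P, Edge.src k e = a ∧ Edge.dst k e = b) x x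


set_option maxHeartbeats 4000000 in
theorem sq_num (kA kB kC kD PA PB PC PD x y z w d : ℤ)
    (h1 : kB = kA + 1 ∨ kB = kA - 1) (h2 : kD = kA + 1 ∨ kD = kA - 1)
    (h3 : kC = kB + 1 ∨ kC = kB - 1) (h4 : kC = kD + 1 ∨ kC = kD - 1)
    (p1 : PB = PA + 1 ∨ PB = PA - 1) (p2 : PD = PA + 1 ∨ PD = PA - 1)
    (p3 : PC = PB + PD - PA) (par : (PA - kA) % 2 = 0)
    (hx : x = 0 ∨ x = 1) (hy : y = 0 ∨ y = 1) (hz : z = 0 ∨ z = 1) (hw : w = 0 ∨ w = 1)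
    (hd : d = 0 ∨ d = 1)
    (sx : x = 1 → kA < PA ∨ kB < PB) (sy : y = 1 → kB < PB ∨ kC < PC)
    (sz : z = 1 → kD < PD ∨ kC < PC) (sw : w = 1 → kA < PA ∨ kD < PD)
    (fl : kA = kC → kB = kD → (kA < PA ∨ kB < PB ∨ kC < PC ∨ kD < PD) → x + y + z + w = 1)
    (a1 : kB ≠ kD → (kA < PA ∨ kD < PD ∨ kC < PC) → w + z + d = 1)
    (a2 : kB ≠ kD → (kA < PA ∨ kB < PB ∨ kC < PC) → x + y + d = 1)
    (ad : kB ≠ kD → d = 1 → kA < PA ∨ kC < PC)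
    (b1 : kA ≠ kC → (kA < PA ∨ kB < PB ∨ kD < PD) → w + x + d = 1)
    (b2 : kA ≠ kC → (kB < PB ∨ kC < PC ∨ kD < PD) → y + z + d = 1)
    (bd : kA ≠ kC → d = 1 → kB < PB ∨ kD < PD) :
    2 * (-(kC - kB) * y + (kD - kA) * w) =
      (min kC PC - min kD PD) * (2 * z - 1) - (min kB PB - min kA PA) * (2 * x - 1) := by
  have hdx : min kB PB - min kA PA = 1 ∨ min kB PB - min kA PA = -1 := by
    clear * - h1 p1 par; omega
  have hdz : min kC PC - min kD PD = 1 ∨ min kC PC - min kD PD = -1 := by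
    clear * - h2 h4 p1 p2 p3 par; omega
  have hr : kC - kB = 1 ∨ kC - kB = -1 := by clear * - h3; omega
  have hl : kD - kA = 1 ∨ kD - kA = -1 := by clear * - h2; omega
  generalize hX : min kB PB - min kA PA = X at *
  generalize hZ : min kC PC - min kD PD = Z at *
  generalize hR : kC - kB = R at *
  generalize hW : kD - kA = W at *
  by_cases iA : kA < PA <;> by_cases iB : kB < PB <;> by_cases iC : kC < PC <;>
    by_cases iD : kD < PD <;>
    simp only [iA, iB, iC, iD, true_or, or_true, or_false, false_or, or_self, forall_const,
      imp_false, imp_true_iff, false_imp_iff] at sx sy sz sw fl a1 a2 ad b1 b2 bd <;>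
    by_cases eB : kB = kD <;> by_cases eA : kA = kC <;>
    simp only [eA, eB, ne_eq, not_true, not_false_iff, forall_const, false_imp_iff, imp_true_iff] at fl a1 a2 ad b1 b2 bd <;>
    (first
     | (exfalso; clear * - h1 h2 h3 h4 eA eB; omega)
     | (rcases hdx with rfl | rfl <;> rcases hdz with rfl | rfl <;> rcases hr with rfl | rfl <;>
          rcases hl with rfl | rfl <;>
          first
          | (exfalso
             clear * - h1 h2 h3 h4 eA eB hX hZ hR hW iA iB iC iD p1 p2 p3 par; omega)
          | (clear h1 h2 h3 h4 eA eB hX hZ hR hW iA iB iC iD p1 p2 p3 par; omega)))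

def xi (M : Set Edge) (e : Edge) : ℤ := if e ∈ M then 1 else 0

theorem xi_01 (M : Set Edge) (e : Edge) : xi M e = 0 ∨ xi M e = 1 := by
  unfold xi; split_ifs <;> simp

theorem xi_one {M : Set Edge} {e : Edge} : xi M e = 1 ↔ e ∈ M := by
  unfold xi; split_ifs <;> simp_all

theorem sum4 (M : Set Edge) (Q : Edge → Prop) (a b c d : Edge)
    (ab : a ≠ b) (ac : a ≠ c) (ad : a ≠ d) (bc : b ≠ c) (bd : b ≠ d) (cd : c ≠ d)
    (qa : Q a) (qb : Q b) (qc : Q c) (qd : Q d)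
    (hall : ∀ e ∈ M, Q e → e = a ∨ e = b ∨ e = c ∨ e = d)
    (hu : ∃! e, e ∈ M ∧ Q e) : xi M a + xi M b + xi M c + xi M d = 1 := by
  obtain ⟨e, ⟨hM, hq⟩, hun⟩ := hu
  have key : ∀ f, Q f → f ≠ e → f ∉ M := fun f hf hne hfM => hne (hun f ⟨hfM, hf⟩)
  rcases hall e hM hq with rfl | rfl | rfl | rfl
  · simp [xi, hM, key b qb ab.symm, key c qc ac.symm, key d qd ad.symm]
  · simp [xi, hM, key a qa ab, key c qc bc.symm, key d qd bd.symm]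
  · simp [xi, hM, key b qb bc, key a qa ac, key d qd cd.symm]
  · simp [xi, hM, key b qb bd, key c qc cd, key a qa ad]

theorem sum3 (M : Set Edge) (Q : Edge → Prop) (a b c : Edge)
    (ab : a ≠ b) (ac : a ≠ c) (bc : b ≠ c)
    (qa : Q a) (qb : Q b) (qc : Q c)
    (hall : ∀ e ∈ M, Q e → e = a ∨ e = b ∨ e = c)
    (hu : ∃! e, e ∈ M ∧ Q e) : xi M a + xi M b + xi M c = 1 := by
  obtain ⟨e, ⟨hM, hq⟩, hun⟩ := hu
  have key : ∀ f, Q f → f ≠ e → f ∉ M := fun f hf hne hfM => hne (hun f ⟨hfM, hf⟩)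
  rcases hall e hM hq with rfl | rfl | rfl
  · simp [xi, hM, key b qb ab.symm, key c qc ac.symm]
  · simp [xi, hM, key a qa ab, key c qc bc.symm]
  · simp [xi, hM, key b qb bc, key a qa ac]

def Pf (i₀ j₀ k₀ : ℤ) (f : ℤ × ℤ) : ℤ := k₀ - |f.1 - i₀| - |f.2 - j₀|

theorem mem_inner (i₀ j₀ k₀ : ℤ) (k : ℤ × ℤ → ℤ) (f : ℤ × ℤ) :
    f ∈ innerF i₀ j₀ k₀ k ↔ k f < Pf i₀ j₀ k₀ f := by
  simp only [innerF, Pf, Set.mem_ofPred_eq]; omega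

theorem step_h {k : ℤ × ℤ → ℤ} (hs : SteppedSurface k) (i j : ℤ) :
    k (i + 1, j) = k (i, j) + 1 ∨ k (i + 1, j) = k (i, j) - 1 := by
  have := hs (i + 1, j) (i, j) (by simp)
  rcases (abs_eq (by norm_num)).1 this with h | h <;> omega

theorem step_v {k : ℤ × ℤ → ℤ} (hs : SteppedSurface k) (i j : ℤ) :
    k (i, j + 1) = k (i, j) + 1 ∨ k (i, j + 1) = k (i, j) - 1 := by
  have := hs (i, j + 1) (i, j) (by simp)
  rcases (abs_eq (by norm_num)).1 this with h | h <;> omega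

theorem abs_step (a b : ℤ) : |a + 1 - b| = |a - b| + 1 ∨ |a + 1 - b| = |a - b| - 1 := by
  rcases abs_cases (a + 1 - b) with h | h <;> rcases abs_cases (a - b) with h' | h' <;> omega

theorem abs_par (a : ℤ) : (|a| - a) % 2 = 0 := by
  rcases abs_cases a with h | h <;> omega

section
variable {i₀ j₀ k₀ : ℤ} {k : ℤ × ℤ → ℤ} {M : Set Edge}

theorem side_h (hM : IsPerfectMatching k (EG i₀ j₀ k₀ k) M) (i j : ℤ) (h : xi M (.h i j) = 1) :
    k (i, j) < Pf i₀ j₀ k₀ (i, j) ∨ k (i, j + 1) < Pf i₀ j₀ k₀ (i, j + 1) := by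
  obtain ⟨_, f, hf, hs⟩ := hM.1 (xi_one.1 h)
  rw [mem_inner] at hf
  rcases hs with rfl | rfl
  · exact Or.inl hf
  · exact Or.inr hf

theorem side_v (hM : IsPerfectMatching k (EG i₀ j₀ k₀ k) M) (i j : ℤ) (h : xi M (.v i j) = 1) :
    k (i, j) < Pf i₀ j₀ k₀ (i, j) ∨ k (i + 1, j) < Pf i₀ j₀ k₀ (i + 1, j) := by
  obtain ⟨_, f, hf, hs⟩ := hM.1 (xi_one.1 h)
  rw [mem_inner] at hf
  rcases hs with rfl | rfl
  · exact Or.inl hf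
  · exact Or.inr hf

theorem inEG (e : Edge) (hv : e.valid k) (f : ℤ × ℤ) (hf : k f < Pf i₀ j₀ k₀ f)
    (hs : e.isSide k f) : e ∈ EG i₀ j₀ k₀ k := ⟨hv, f, (mem_inner _ _ _ _ _).2 hf, hs⟩

theorem inc (i j : ℤ) (b : Bool) (e : Edge) (h : Edge.mem k ((i, j), b) e) :
    (e = .h i j ∧ b = Edge.tAD k (i, j)) ∨ (e = .h (i + 1) j ∧ b = Edge.tBC k (i, j)) ∨
    (e = .v i j ∧ b = false) ∨ (e = .v i (j + 1) ∧ b = (Edge.tAD k (i, j) || Edge.tBC k (i, j)))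
    ∨ (e = .d i j) := by
  rcases e with ⟨a, c⟩ | ⟨a, c⟩ | ⟨a, c⟩ <;>
    simp only [Edge.mem, Edge.ends, Prod.mk.injEq] at h <;>
    rcases h with ⟨⟨h1, h2⟩, h3⟩ | ⟨⟨h1, h2⟩, h3⟩
  · obtain rfl : a = i + 1 := by omega
    subst h2; simp at h3; simp [h3]
  · subst h1 h2; simp [h3]
  · obtain rfl : c = j + 1 := by omega
    subst h1; simp at h3; simp [h3]
  · subst h1 h2; simp [h3]
  · subst h1 h2; simp
  · subst h1 h2; simp

theorem sq_id (hs : SteppedSurface k) (hodd : Odd (i₀ + j₀ + k₀))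
    (hoddk : ∀ f : ℤ × ℤ, Odd (f.1 + f.2 + k f))
    (hM : IsPerfectMatching k (EG i₀ j₀ k₀ k) M) (i j : ℤ) :
    2 * (-(k (i + 1, j + 1) - k (i + 1, j)) * xi M (.h (i + 1) j)
        + (k (i, j + 1) - k (i, j)) * xi M (.h i j)) =
      (min (k (i + 1, j + 1)) (Pf i₀ j₀ k₀ (i + 1, j + 1))
        - min (k (i, j + 1)) (Pf i₀ j₀ k₀ (i, j + 1))) * (2 * xi M (.v i (j + 1)) - 1)
      - (min (k (i + 1, j)) (Pf i₀ j₀ k₀ (i + 1, j))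
        - min (k (i, j)) (Pf i₀ j₀ k₀ (i, j))) * (2 * xi M (.v i j) - 1) := by
  have h1 := step_h hs i j
  have h2 := step_v hs i j
  have h3 := step_v hs (i + 1) j
  have h4 := step_h hs i (j + 1)
  have vtx : ∀ b : Bool, ∀ e f, e.valid k → k f < Pf i₀ j₀ k₀ f → e.isSide k f →
      Edge.mem k ((i, j), b) e → ∃! e, e ∈ M ∧ Edge.mem k ((i, j), b) e :=
    fun b e f hv hf hsd hm => hM.2 _ ⟨e, inEG e hv f hf hsd, hm⟩
  refine sq_num (k (i, j)) (k (i + 1, j)) (k (i + 1, j + 1)) (k (i, j + 1))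
    (Pf i₀ j₀ k₀ (i, j)) (Pf i₀ j₀ k₀ (i + 1, j)) (Pf i₀ j₀ k₀ (i + 1, j + 1))
    (Pf i₀ j₀ k₀ (i, j + 1)) (xi M (.v i j)) (xi M (.h (i + 1) j)) (xi M (.v i (j + 1)))
    (xi M (.h i j)) (xi M (.d i j)) h1 h2 h3 h4 ?_ ?_ ?_ ?_ (xi_01 _ _) (xi_01 _ _) (xi_01 _ _)
    (xi_01 _ _) (xi_01 _ _) (side_v hM _ _) (side_h hM _ _) (side_v hM _ _) (side_h hM _ _)
    ?_ ?_ ?_ ?_ ?_ ?_ ?_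
  · have := abs_step i i₀; simp only [Pf]; omega
  · have := abs_step j j₀; simp only [Pf]; omega
  · simp only [Pf]; omega
  · have a := abs_par (i - i₀)
    have b := abs_par (j - j₀)
    obtain ⟨u, hu⟩ := hodd
    obtain ⟨w, hw⟩ := hoddk (i, j)
    simp only [Pf] at *; omega
  · intro e1 e2 hin
    have tA : Edge.tAD k (i, j) = false := by simp [Edge.tAD, e2]
    have tB : Edge.tBC k (i, j) = false := by simp [Edge.tBC, e1]
    have q1 : Edge.mem k ((i, j), false) (.v i j) := by simp [Edge.mem, Edge.ends]
    have q2 : Edge.mem k ((i, j), false) (.h (i + 1) j) := by simp [Edge.mem, Edge.ends, tB]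
    have q3 : Edge.mem k ((i, j), false) (.v i (j + 1)) := by simp [Edge.mem, Edge.ends, tA, tB]
    have q4 : Edge.mem k ((i, j), false) (.h i j) := by simp [Edge.mem, Edge.ends, tA]
    refine sum4 M (Edge.mem k ((i, j), false)) _ _ _ _ (by simp) (by simp) (by simp) (by simp)
      (by simp) (by simp) q1 q2 q3 q4 ?_ ?_
    · intro e he hm
      have hv := (hM.1 he).1
      rcases inc i j _ e hm with h | h | h | h | h
      · simp [h]
      · simp [h]
      · simp [h]
      · simp [h]
      · subst h; simp [Edge.valid, e1, e2] at hv
    · rcases hin with h | h | h | h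
      · exact vtx _ (.v i j) _ trivial h (by simp [Edge.isSide]) q1
      · exact vtx _ (.v i j) _ trivial h (by simp [Edge.isSide]) q1
      · exact vtx _ (.v i (j + 1)) _ trivial h (by simp [Edge.isSide]) q3
      · exact vtx _ (.v i (j + 1)) _ trivial h (by simp [Edge.isSide]) q3
  · intro e2 hin
    have e1 : k (i, j) = k (i + 1, j + 1) := by omega
    have tA : Edge.tAD k (i, j) = true := by simp [Edge.tAD, e2]
    have tB : Edge.tBC k (i, j) = false := by simp [Edge.tBC, e1]
    have q3 : Edge.mem k ((i, j), true) (.v i (j + 1)) := by simp [Edge.mem, Edge.ends, tA, tB]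
    have q4 : Edge.mem k ((i, j), true) (.h i j) := by simp [Edge.mem, Edge.ends, tA]
    have q5 : Edge.mem k ((i, j), true) (.d i j) := by simp [Edge.mem, Edge.ends, tA]
    refine sum3 M (Edge.mem k ((i, j), true)) _ _ _ (by simp) (by simp) (by simp)
      q4 q3 q5 ?_ ?_
    · intro e he hm
      rcases inc i j _ e hm with h | h | h | h | h <;>
        first
        | (exfalso; simp [tA, tB] at h; done)
        | simp [h]
    · rcases hin with h | h | h
      · exact vtx _ (.h i j) _ trivial h (by simp [Edge.isSide]) q4
      · exact vtx _ (.h i j) _ trivial h (by simp [Edge.isSide]) q4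
      · exact vtx _ (.v i (j + 1)) _ trivial h (by simp [Edge.isSide]) q3
  · intro e2 hin
    have e1 : k (i, j) = k (i + 1, j + 1) := by omega
    have tA : Edge.tAD k (i, j) = true := by simp [Edge.tAD, e2]
    have tB : Edge.tBC k (i, j) = false := by simp [Edge.tBC, e1]
    have q1 : Edge.mem k ((i, j), false) (.v i j) := by simp [Edge.mem, Edge.ends]
    have q2 : Edge.mem k ((i, j), false) (.h (i + 1) j) := by simp [Edge.mem, Edge.ends, tB]
    have q5 : Edge.mem k ((i, j), false) (.d i j) := by simp [Edge.mem, Edge.ends, tB]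
    refine sum3 M (Edge.mem k ((i, j), false)) _ _ _ (by simp) (by simp) (by simp)
      q1 q2 q5 ?_ ?_
    · intro e he hm
      rcases inc i j _ e hm with h | h | h | h | h <;>
        first
        | (exfalso; simp [tA, tB] at h; done)
        | simp [h]
    · rcases hin with h | h | h
      · exact vtx _ (.v i j) _ trivial h (by simp [Edge.isSide]) q1
      · exact vtx _ (.v i j) _ trivial h (by simp [Edge.isSide]) q1
      · exact vtx _ (.h (i + 1) j) _ trivial h (by simp [Edge.isSide]) q2
  · intro e2 hd
    obtain ⟨_, f, hf, hsd⟩ := hM.1 (xi_one.1 hd)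
    have tA : Edge.tAD k (i, j) = true := by simp [Edge.tAD, e2]
    rw [mem_inner] at hf
    simp only [Edge.isSide, tA, if_true] at hsd
    rcases hsd with rfl | rfl
    · exact Or.inl hf
    · exact Or.inr hf
  · intro e1 hin
    have e2 : k (i + 1, j) = k (i, j + 1) := by omega
    have tA : Edge.tAD k (i, j) = false := by simp [Edge.tAD, e2]
    have tB : Edge.tBC k (i, j) = true := by simp [Edge.tBC, e1]
    have q1 : Edge.mem k ((i, j), false) (.v i j) := by simp [Edge.mem, Edge.ends]
    have q4 : Edge.mem k ((i, j), false) (.h i j) := by simp [Edge.mem, Edge.ends, tA]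
    have q5 : Edge.mem k ((i, j), false) (.d i j) := by simp [Edge.mem, Edge.ends, tA]
    refine sum3 M (Edge.mem k ((i, j), false)) _ _ _ (by simp) (by simp) (by simp)
      q4 q1 q5 ?_ ?_
    · intro e he hm
      rcases inc i j _ e hm with h | h | h | h | h <;>
        first
        | (exfalso; simp [tA, tB] at h; done)
        | simp [h]
    · rcases hin with h | h | h
      · exact vtx _ (.v i j) _ trivial h (by simp [Edge.isSide]) q1
      · exact vtx _ (.v i j) _ trivial h (by simp [Edge.isSide]) q1
      · exact vtx _ (.h i j) _ trivial h (by simp [Edge.isSide]) q4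
  · intro e1 hin
    have e2 : k (i + 1, j) = k (i, j + 1) := by omega
    have tA : Edge.tAD k (i, j) = false := by simp [Edge.tAD, e2]
    have tB : Edge.tBC k (i, j) = true := by simp [Edge.tBC, e1]
    have q2 : Edge.mem k ((i, j), true) (.h (i + 1) j) := by simp [Edge.mem, Edge.ends, tB]
    have q3 : Edge.mem k ((i, j), true) (.v i (j + 1)) := by simp [Edge.mem, Edge.ends, tA, tB]
    have q5 : Edge.mem k ((i, j), true) (.d i j) := by simp [Edge.mem, Edge.ends, tB]
    refine sum3 M (Edge.mem k ((i, j), true)) _ _ _ (by simp) (by simp) (by simp)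
      q2 q3 q5 ?_ ?_
    · intro e he hm
      rcases inc i j _ e hm with h | h | h | h | h <;>
        first
        | (exfalso; simp [tA, tB] at h; done)
        | simp [h]
    · rcases hin with h | h | h
      · exact vtx _ (.h (i + 1) j) _ trivial h (by simp [Edge.isSide]) q2
      · exact vtx _ (.h (i + 1) j) _ trivial h (by simp [Edge.isSide]) q2
      · exact vtx _ (.v i (j + 1)) _ trivial h (by simp [Edge.isSide]) q3
  · intro e1 hd
    have e2 : k (i + 1, j) = k (i, j + 1) := by omega
    obtain ⟨_, f, hf, hsd⟩ := hM.1 (xi_one.1 hd)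
    have tA : Edge.tAD k (i, j) = false := by simp [Edge.tAD, e2]
    rw [mem_inner] at hf
    simp only [Edge.isSide, tA] at hsd
    rcases hsd with rfl | rfl
    · exact Or.inl hf
    · exact Or.inr hf

/-- signed horizontal edge indicator -/
def sg (k : ℤ × ℤ → ℤ) (M : Set Edge) (i j : ℤ) : ℤ := -(k (i, j + 1) - k (i, j)) * xi M (.h i j)

def Hs (k : ℤ × ℤ → ℤ) (M : Set Edge) (L i : ℤ) (n : ℕ) : ℤ :=
  ∑ t ∈ Finset.range n, sg k M i (L + t)

theorem far (hfund : ∀ f : ℤ × ℤ, fund f ≤ k f) (f : ℤ × ℤ)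
    (h : k₀ + 1 ≤ |f.1 - i₀| ∨ k₀ + 1 ≤ |f.2 - j₀|) : ¬ k f < Pf i₀ j₀ k₀ f := by
  have := hfund f
  have h1 := abs_nonneg (f.1 - i₀)
  have h2 := abs_nonneg (f.2 - j₀)
  simp only [fund, Pf] at *; omega

theorem row_id (hs : SteppedSurface k) (hodd : Odd (i₀ + j₀ + k₀))
    (hoddk : ∀ f : ℤ × ℤ, Odd (f.1 + f.2 + k f))
    (hfund : ∀ f : ℤ × ℤ, fund f ≤ k f)
    (hM : IsPerfectMatching k (EG i₀ j₀ k₀ k) M) (L : ℤ) (hL : k₀ + 1 ≤ |L - j₀|) (i : ℤ) (n : ℕ) :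
    2 * Hs k M L (i + 1) n + |i + 1 - i₀| - (2 * Hs k M L i n + |i - i₀|) =
      (min (k (i + 1, L + n)) (Pf i₀ j₀ k₀ (i + 1, L + n))
        - min (k (i, L + n)) (Pf i₀ j₀ k₀ (i, L + n))) * (2 * xi M (.v i (L + n)) - 1) := by
  induction n with
  | zero =>
    have f1 := far (i₀ := i₀) (j₀ := j₀) (k₀ := k₀) hfund (i, L) (Or.inr hL)
    have f2 := far (i₀ := i₀) (j₀ := j₀) (k₀ := k₀) hfund (i + 1, L) (Or.inr hL)
    have hx : xi M (.v i L) = 0 := by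
      rcases xi_01 M (.v i L) with h | h
      · exact h
      · exact absurd (side_v hM i L h) (by tauto)
    simp only [Hs, Finset.range_zero, Finset.sum_empty, Nat.cast_zero, add_zero, hx]
    rw [min_eq_right (by omega), min_eq_right (by omega)]
    simp only [Pf]; ring
  | succ n ih =>
    have sq := sq_id hs hodd hoddk hM i (L + n)
    have e : L + ((n + 1 : ℕ) : ℤ) = L + n + 1 := by push_cast; ring
    rw [e]
    simp only [Hs, Finset.sum_range_succ] at ih ⊢
    simp only [sg] at ih ⊢
    linarith

theorem Hs_far (hfund : ∀ f : ℤ × ℤ, fund f ≤ k f)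
    (hM : IsPerfectMatching k (EG i₀ j₀ k₀ k) M) (L i : ℤ) (n : ℕ) (hi : k₀ + 1 ≤ |i - i₀|) :
    Hs k M L i n = 0 := by
  refine Finset.sum_eq_zero fun t _ => ?_
  have hx : xi M (.h i (L + t)) = 0 := by
    rcases xi_01 M (.h i (L + t)) with h | h
    · exact h
    · have f1 := far (i₀ := i₀) (j₀ := j₀) (k₀ := k₀) hfund (i, L + t) (Or.inl hi)
      have f2 := far (i₀ := i₀) (j₀ := j₀) (k₀ := k₀) hfund (i, L + t + 1) (Or.inl hi)
      exact absurd (side_h hM _ _ h) (by tauto)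
  simp [sg, hx]

theorem kp_step (hs : SteppedSurface k) (i j : ℤ) :
    |min (k (i + 1, j)) (Pf i₀ j₀ k₀ (i + 1, j)) - min (k (i, j)) (Pf i₀ j₀ k₀ (i, j))| ≤ 1 := by
  have h1 := step_h hs i j
  have h2 := abs_step i i₀
  simp only [Pf]
  rw [abs_le]; omega

theorem Hs_nonneg (hs : SteppedSurface k) (hodd : Odd (i₀ + j₀ + k₀))
    (hoddk : ∀ f : ℤ × ℤ, Odd (f.1 + f.2 + k f))
    (hfund : ∀ f : ℤ × ℤ, fund f ≤ k f)
    (hM : IsPerfectMatching k (EG i₀ j₀ k₀ k) M) (L : ℤ) (hL : k₀ + 1 ≤ |L - j₀|) (i : ℤ) (n : ℕ) :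
    0 ≤ Hs k M L i n := by
  have lip : ∀ i, |2 * Hs k M L (i + 1) n + |i + 1 - i₀| - (2 * Hs k M L i n + |i - i₀|)| ≤ 1 := by
    intro i
    rw [row_id hs hodd hoddk hfund hM L hL i n]
    have := kp_step (i₀ := i₀) (j₀ := j₀) (k₀ := k₀) hs i (L + n)
    rcases xi_01 M (.v i (L + n)) with h | h <;> rw [h]
    · rw [abs_le] at *; omega
    · rw [abs_le] at *; omega
  have right : ∀ m : ℕ, 2 * Hs k M L (i + m) n + |i + m - i₀| - (2 * Hs k M L i n + |i - i₀|) ≤ m := by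
    intro m
    induction m with
    | zero => simp
    | succ m ih =>
      have := (abs_le.1 (lip (i + m))).2
      rw [add_assoc i] at this
      push_cast
      linarith
  have left : ∀ m : ℕ, 2 * Hs k M L (i - m) n + |i - m - i₀| - (2 * Hs k M L i n + |i - i₀|) ≤ m := by
    intro m
    induction m with
    | zero => simp
    | succ m ih =>
      have := (abs_le.1 (lip (i - (m + 1)))).1
      rw [show i - ((m : ℤ) + 1) + 1 = i - m by ring] at this
      push_cast
      linarith
  have hK : (k₀ + 1 : ℤ) ≤ ((k₀ + 1).toNat : ℤ) := Int.self_le_toNat _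
  set K := (k₀ + 1).toNat
  rcases le_total i₀ i with h | h
  · have := right K
    have e : |i + K - i₀| = i + K - i₀ := abs_of_nonneg (by omega)
    rw [Hs_far hfund hM L (i + K) n (by omega), e, abs_of_nonneg (by omega : 0 ≤ i - i₀)] at this
    omega
  · have := left K
    have e : |i - K - i₀| = -(i - K - i₀) := abs_of_nonpos (by omega)
    rw [Hs_far hfund hM L (i - K) n (by omega), e, abs_of_nonpos (by omega : i - i₀ ≤ 0)] at this
    omega

theorem Hs_top (hs : SteppedSurface k) (hodd : Odd (i₀ + j₀ + k₀))
    (hoddk : ∀ f : ℤ × ℤ, Odd (f.1 + f.2 + k f))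
    (hfund : ∀ f : ℤ × ℤ, fund f ≤ k f)
    (hM : IsPerfectMatching k (EG i₀ j₀ k₀ k) M) (L : ℤ) (hL : k₀ + 1 ≤ |L - j₀|) (i : ℤ) (n : ℕ)
    (hn : k₀ + 1 ≤ |L + n - j₀|) :
    Hs k M L i n = 0 := by
  have st : ∀ i, Hs k M L (i + 1) n = Hs k M L i n := by
    intro i
    have r := row_id hs hodd hoddk hfund hM L hL i n
    have f1 := far (i₀ := i₀) (j₀ := j₀) (k₀ := k₀) hfund (i, L + n) (Or.inr hn)
    have f2 := far (i₀ := i₀) (j₀ := j₀) (k₀ := k₀) hfund (i + 1, L + n) (Or.inr hn)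
    have hx : xi M (.v i (L + n)) = 0 := by
      rcases xi_01 M (.v i (L + n)) with h | h
      · exact h
      · exact absurd (side_v hM _ _ h) (by tauto)
    rw [hx, min_eq_right (by omega), min_eq_right (by omega)] at r
    simp only [Pf] at r
    linarith
  have right : ∀ m : ℕ, Hs k M L (i + m) n = Hs k M L i n := by
    intro m
    induction m with
    | zero => simp
    | succ m ih => rw [← ih, ← st (i + m)]; push_cast; rw [add_assoc]
  rw [← right ((k₀ + 1).toNat + (i₀ - i).toNat)]
  apply Hs_far hfund hM
  rw [abs_of_nonneg] <;> push_cast <;> omega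

theorem white_h (hs : SteppedSurface k) (i j : ℤ) :
    isWhite k (Edge.ends k (Edge.h i j)).1 = decide (k (i, j) < k (i, j + 1)) := by
  have h1 := step_h hs (i - 1) j
  have h2 := step_v hs (i - 1) j
  have h3 := step_v hs i j
  have h4 := step_h hs (i - 1) (j + 1)
  simp only [sub_add_cancel] at h1 h4
  simp only [isWhite, Edge.ends, Edge.tBC, sub_add_cancel]
  by_cases c1 : k (i, j) < k (i - 1, j) <;> by_cases c2 : k (i - 1, j) = k (i, j + 1) <;>
    by_cases c3 : k (i, j) < k (i, j + 1) <;> simp [c1, c2, c3] <;> omega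

theorem count (T : Set ℤ) (L : ℤ) (hT : ∀ b ∈ T, L ≤ b) (n : ℕ) :
    (({b ∈ T | b < L + n}).ncard : ℤ) = ∑ t ∈ Finset.range n, if L + (t : ℤ) ∈ T then (1 : ℤ) else 0 := by
  have fin : ∀ m : ℤ, ({b ∈ T | b < m}).Finite := fun m =>
    (Set.finite_Ico L m).subset fun b hb => ⟨hT b hb.1, hb.2⟩
  induction n with
  | zero =>
    have : {b ∈ T | b < L + ((0 : ℕ) : ℤ)} = ∅ := by
      ext b; simp; intro hb; exact hT b hb
    rw [this]; simp
  | succ n ih =>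
    rw [Finset.sum_range_succ, ← ih]
    split_ifs with h
    · have : {b ∈ T | b < L + ((n + 1 : ℕ) : ℤ)} = insert (L + (n : ℤ)) {b ∈ T | b < L + (n : ℤ)} := by
        ext y
        simp only [Set.mem_ofPred_eq, Set.mem_insert_iff]
        constructor
        · rintro ⟨a, b⟩; by_cases c : y = L + (n : ℤ)
          · exact Or.inl c
          · right; refine ⟨a, ?_⟩; push_cast at b; omega
        · rintro (rfl | ⟨a, b⟩)
          · refine ⟨h, ?_⟩; push_cast; omega
          · refine ⟨a, ?_⟩; push_cast; omega
      rw [this, Set.ncard_insert_of_notMem (by simp) (fin _)]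
      push_cast; rfl
    · have : {b ∈ T | b < L + ((n + 1 : ℕ) : ℤ)} = {b ∈ T | b < L + (n : ℤ)} := by
        ext y
        simp only [Set.mem_ofPred_eq]
        constructor
        · rintro ⟨a, b⟩; refine ⟨a, ?_⟩
          push_cast at b
          rcases lt_or_eq_of_le (by omega : y ≤ L + (n : ℤ)) with c | c
          · exact c
          · subst c; exact absurd a h
        · rintro ⟨a, b⟩
          refine ⟨a, ?_⟩; push_cast; omega
      rw [this]; simp

end

/-- **Column balance and domination** (Proposition `prop:main`, parts 2 and 3): in every
column `i`, a perfect matching `M` of `G` contains as many black-white horizontal edges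
`S(i,·)` as white-black horizontal edges `N(i,·)`, and every bottom-to-top prefix
contains at least as many `S`-edges as `N`-edges. -/
theorem column_balance_and_domination
    (i₀ j₀ k₀ : ℤ) (k : ℤ × ℤ → ℤ)
    (hstep : SteppedSurface k)
    (hodd : Odd (i₀ + j₀ + k₀))
    (hoddk : ∀ f : ℤ × ℤ, Odd (f.1 + f.2 + k f))
    (hk0 : k (i₀, j₀) ≤ k₀)
    (hfund : ∀ f : ℤ × ℤ, fund f ≤ k f)
    (M : Set Edge) (hM : IsPerfectMatching k (EG i₀ j₀ k₀ k) M) :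
    (∀ i : ℤ, (SSet k M i).ncard = (NSet k M i).ncard) ∧
    (∀ i j : ℤ, ({b ∈ NSet k M i | b ≤ j}).ncard ≤ ({b ∈ SSet k M i | b ≤ j}).ncard) := by
  have hK : (k₀ + 1 : ℤ) ≤ ((k₀ + 1).toNat : ℤ) := Int.self_le_toNat _
  set K := (k₀ + 1).toNat with hKdef
  set L : ℤ := j₀ - K - 2 with hLdef
  have hL : k₀ + 1 ≤ |L - j₀| := by rw [abs_of_nonpos (by omega)]; omega
  have range_h : ∀ i m, Edge.h i m ∈ M → L ≤ m ∧ m < L + ((2 * K + 4 : ℕ) : ℤ) := by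
    intro i m hm
    by_contra hc
    have f1 := far (i₀ := i₀) (j₀ := j₀) (k₀ := k₀) hfund (i, m)
    have f2 := far (i₀ := i₀) (j₀ := j₀) (k₀ := k₀) hfund (i, m + 1)
    have sd := side_h hM i m (xi_one.2 hm)
    simp only at f1 f2
    push_cast at hc
    have c1 : k₀ + 1 ≤ |m - j₀| := by
      rcases abs_cases (m - j₀) with h | h <;> omega
    have c2 : k₀ + 1 ≤ |m + 1 - j₀| := by
      rcases abs_cases (m + 1 - j₀) with h | h <;> omega
    tauto
  let S' : ℤ → Set ℤ := fun i => {m | Edge.h i m ∈ M ∧ isWhite k (Edge.ends k (Edge.h i m)).1 = false}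
  have hS' : ∀ i m, m ∈ S' i → L ≤ m := fun i m h => (range_h i m h.1).1
  have hN' : ∀ i m, m ∈ NSet k M i → L ≤ m := fun i m h => (range_h i m h.1).1
  have sg_eq : ∀ i m, sg k M i m =
      (if m ∈ S' i then (1 : ℤ) else 0) - (if m ∈ NSet k M i then (1 : ℤ) else 0) := by
    intro i m
    have h3 := step_v hstep i m
    have w := white_h hstep i m
    have e1 : m ∈ S' i ↔ (Edge.h i m ∈ M ∧ ¬ k (i, m) < k (i, m + 1)) := by
      simp only [S', Set.mem_ofPred_eq, w, decide_eq_false_iff_not]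
    have e2 : m ∈ NSet k M i ↔ (Edge.h i m ∈ M ∧ k (i, m) < k (i, m + 1)) := by
      simp only [NSet, Set.mem_ofPred_eq, w, decide_eq_true_iff]
    simp only [e1, e2, sg, xi]
    by_cases hm : Edge.h i m ∈ M
    · rcases h3 with h | h <;> simp [hm, h] <;> omega
    · simp [hm]
  have disj : ∀ i m, m ∈ S' i → m ∉ NSet k M i := by
    intro i m h1 h2
    have a := h1.2
    have b := h2.2
    rw [a] at b; cases b
  have Hs_eq : ∀ i (n : ℕ), Hs k M L i n =
      (({b ∈ S' i | b < L + n}).ncard : ℤ) - (({b ∈ NSet k M i | b < L + n}).ncard : ℤ) := by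
    intro i n
    rw [count _ L (hS' i), count _ L (hN' i), ← Finset.sum_sub_distrib]
    refine Finset.sum_congr rfl fun t _ => ?_
    rw [sg_eq i]
    congr
  have inj : Function.Injective (fun m : ℤ => m + 1) := fun a b h => by simpa using h
  constructor
  · intro i
    have e : SSet k M i = (fun m : ℤ => m + 1) '' (S' i) := by
      ext b
      simp only [SSet, S', Set.mem_ofPred_eq, Set.mem_image]
      constructor
      · intro h; exact ⟨b - 1, h, by ring⟩
      · rintro ⟨m, hm, rfl⟩; simpa using hm
    rw [e, Set.ncard_image_of_injective _ inj]
    have h := Hs_top hstep hodd hoddk hfund hM L hL i (2 * K + 4)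
      (by push_cast; rw [abs_of_nonneg (by omega)]; omega)
    rw [Hs_eq] at h
    have a1 : {b ∈ S' i | b < L + ((2 * K + 4 : ℕ) : ℤ)} = S' i := by
      ext b; simp only [Set.mem_ofPred_eq, and_iff_left_iff_imp]
      intro hb; exact (range_h i b hb.1).2
    have a2 : {b ∈ NSet k M i | b < L + ((2 * K + 4 : ℕ) : ℤ)} = NSet k M i := by
      ext b; simp only [Set.mem_ofPred_eq, and_iff_left_iff_imp]
      intro hb; exact (range_h i b hb.1).2
    rw [a1, a2] at h
    omega
  · intro i j
    by_cases hj : j < L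
    · have : {b ∈ NSet k M i | b ≤ j} = ∅ := by
        ext b; simp only [Set.mem_ofPred_eq, Set.mem_empty_iff_false, iff_false, not_and]
        intro hb; have := hN' i b hb; omega
      rw [this]; simp
    · obtain ⟨n, hn⟩ := Int.eq_ofNat_of_zero_le (by omega : 0 ≤ j - L)
      obtain rfl : j = L + n := by omega
      have e : {b ∈ SSet k M i | b ≤ L + n} = (fun m : ℤ => m + 1) '' {b ∈ S' i | b < L + n} := by
        ext b
        simp only [SSet, S', Set.mem_ofPred_eq, Set.mem_image]
        constructor
        · rintro ⟨h, h'⟩; exact ⟨b - 1, ⟨h, by omega⟩, by ring⟩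
        · rintro ⟨m, ⟨hm, hm'⟩, rfl⟩
          refine ⟨by simpa using hm, by omega⟩
      have e' : {b ∈ NSet k M i | b ≤ L + n} = {b ∈ NSet k M i | b < L + ((n + 1 : ℕ) : ℤ)} := by
        ext b
        simp only [Set.mem_ofPred_eq]
        push_cast
        rw [← add_assoc, Int.lt_add_one_iff]
      rw [e, Set.ncard_image_of_injective _ inj, e']
      have p0 := Hs_nonneg hstep hodd hoddk hfund hM L hL i n
      have p1 := Hs_nonneg hstep hodd hoddk hfund hM L hL i (n + 1)
      rw [Hs_eq] at p0 p1
      have c1 := count (S' i) L (hS' i) n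
      have c2 := count (S' i) L (hS' i) (n + 1)
      have c3 := count (NSet k M i) L (hN' i) n
      have c4 := count (NSet k M i) L (hN' i) (n + 1)
      rw [Finset.sum_range_succ, ← c1] at c2
      rw [Finset.sum_range_succ, ← c3] at c4
      have d := disj i (L + n)
      by_cases q : L + (n : ℤ) ∈ S' i
      · simp only [q, d q, if_true, if_false] at c2 c4
        omega
      · simp only [q, if_false] at c2
        omega

end OctahedronTSystem
end
end

section
/- Infinite completion bijection (Proposition prop:infcomp): Let G = G_{p,k} be the graph with open faces associated with p and an admissible stepped surface k (with k₀ ≥ k(i₀,j₀) and k ≥ fund), and let G_∞ = G_{k_p} where k_p(i,j) = min(k(i,j), k₀ − |i−i₀| − |j−j₀|). Then the map M ↦ M ∪ { diagonal edges of E(G_∞) \ E(G) } is a bijection from the set of perfect matchings of G onto the set of acceptable perfect matchings of G_∞, i.e. perfect matchings M∞ of G_∞ such that M∞ \ E(G) is exactly the set of all diagonal edges of E(G_∞) \ E(G). -/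
noncomputable section
open Classical

namespace OctahedronTSystem

/-- local height of the cone -/
def coneL (i₀ j₀ k₀ : ℤ) : ℤ × ℤ → ℤ := fun f => k₀ - |f.1 - i₀| - |f.2 - j₀|

/-- Local facts about a unit square. -/
structure SqFacts (k L : ℤ × ℤ → ℤ) (i j : ℤ) : Prop where
  k1 : k (i, j) - k (i+1, j) = 1 ∨ k (i, j) - k (i+1, j) = -1
  k2 : k (i+1, j) - k (i+1, j+1) = 1 ∨ k (i+1, j) - k (i+1, j+1) = -1
  k3 : k (i+1, j+1) - k (i, j+1) = 1 ∨ k (i+1, j+1) - k (i, j+1) = -1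
  k4 : k (i, j+1) - k (i, j) = 1 ∨ k (i, j+1) - k (i, j) = -1
  l1 : L (i, j) - L (i+1, j) = 1 ∨ L (i, j) - L (i+1, j) = -1
  l2 : L (i+1, j) - L (i+1, j+1) = 1 ∨ L (i+1, j) - L (i+1, j+1) = -1
  l3 : L (i+1, j+1) - L (i, j+1) = 1 ∨ L (i+1, j+1) - L (i, j+1) = -1
  l4 : L (i, j+1) - L (i, j) = 1 ∨ L (i, j+1) - L (i, j) = -1
  l5 : ¬ (L (i, j) = L (i+1, j+1) ∧ L (i+1, j) = L (i, j+1))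
  par : (L (i, j) - k (i, j)) % 2 = 0

theorem sqFacts (i₀ j₀ k₀ : ℤ) (k : ℤ × ℤ → ℤ) (hstep : SteppedSurface k)
    (hodd : Odd (i₀ + j₀ + k₀)) (hoddk : ∀ f : ℤ × ℤ, Odd (f.1 + f.2 + k f)) (i j : ℤ) :
    SqFacts k (coneL i₀ j₀ k₀) i j := by
  have e (x : ℤ) (h : |x| = 1) : x = 1 ∨ x = -1 := by
    rcases abs_cases x with h1 | h1 <;> omega
  have hp := hoddk (i, j)
  rw [Int.odd_iff] at hp hodd
  simp only at hp
  refine ⟨e _ (hstep _ _ (by simp)), e _ (hstep _ _ (by simp)), e _ (hstep _ _ (by simp)),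
    e _ (hstep _ _ (by simp)), ?_, ?_, ?_, ?_, ?_, ?_⟩ <;> simp only [coneL] <;>
  rcases abs_cases (i - i₀) with h1 | h1 <;> rcases abs_cases (j - j₀) with h2 | h2 <;>
  rcases abs_cases (i + 1 - i₀) with h3 | h3 <;> rcases abs_cases (j + 1 - j₀) with h4 | h4 <;>
  omega

/-- minimum surface -/
def mn (k L : ℤ × ℤ → ℤ) : ℤ × ℤ → ℤ := fun f => min (k f) (L f)

theorem kAdj_eq (i₀ j₀ k₀ : ℤ) (k : ℤ × ℤ → ℤ) : kAdj i₀ j₀ k₀ k = mn k (coneL i₀ j₀ k₀) := rfl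

theorem innerF_iff (i₀ j₀ k₀ : ℤ) (k : ℤ × ℤ → ℤ) (f : ℤ × ℤ) :
    f ∈ innerF i₀ j₀ k₀ k ↔ k f < coneL i₀ j₀ k₀ f := by
  simp only [innerF, coneL, Set.mem_ofPred_eq]
  omega

/-- the square is split -/
def spl (k : ℤ × ℤ → ℤ) (s : ℤ × ℤ) : Bool := Edge.tAD k s || Edge.tBC k s

section local_lemmas
variable {k L : ℤ × ℤ → ℤ} {i j : ℤ}

theorem lemE (H : SqFacts k L i j)
    (h : k (i+1, j) < L (i+1, j) ∨ k (i+1, j+1) < L (i+1, j+1)) :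
    (Edge.tBC k (i, j) && spl (mn k L) (i, j)) = Edge.tBC (mn k L) (i, j) := by
  obtain ⟨k1, k2, k3, k4, l1, l2, l3, l4, l5, par⟩ := H
  rw [Bool.eq_iff_iff]
  simp only [spl, Edge.tAD, Edge.tBC, Bool.and_eq_true, Bool.or_eq_true, decide_eq_true_eq]
  simp only [mn]
  omega

theorem lemW (H : SqFacts k L i j)
    (h : k (i, j) < L (i, j) ∨ k (i, j+1) < L (i, j+1)) :
    (Edge.tAD k (i, j) && spl (mn k L) (i, j)) = Edge.tAD (mn k L) (i, j) := by
  obtain ⟨k1, k2, k3, k4, l1, l2, l3, l4, l5, par⟩ := H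
  rw [Bool.eq_iff_iff]
  simp only [spl, Edge.tAD, Edge.tBC, Bool.and_eq_true, Bool.or_eq_true, decide_eq_true_eq]
  simp only [mn]
  omega

theorem lemN (H : SqFacts k L i j)
    (h : k (i, j+1) < L (i, j+1) ∨ k (i+1, j+1) < L (i+1, j+1)) :
    (spl k (i, j) && spl (mn k L) (i, j)) = spl (mn k L) (i, j) := by
  obtain ⟨k1, k2, k3, k4, l1, l2, l3, l4, l5, par⟩ := H
  rw [Bool.eq_iff_iff]
  simp only [spl, Edge.tAD, Edge.tBC, Bool.and_eq_true, Bool.or_eq_true, decide_eq_true_eq]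
  simp only [mn]
  omega

theorem lemD (H : SqFacts k L i j) (hv : (Edge.d i j).valid k)
    (h : ∃ f, k f < L f ∧ (Edge.d i j).isSide k f) :
    (Edge.tAD k (i, j) && spl (mn k L) (i, j)) = Edge.tAD (mn k L) (i, j) ∧
    (Edge.tBC k (i, j) && spl (mn k L) (i, j)) = Edge.tBC (mn k L) (i, j) ∧
    (Edge.d i j).valid (mn k L) := by
  obtain ⟨k1, k2, k3, k4, l1, l2, l3, l4, l5, par⟩ := H
  have hB : ∀ a b : Bool, a = b ↔ (a = true ↔ b = true) := fun a b => Bool.eq_iff_iff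
  rw [hB (_ && _) (Edge.tAD _ _), hB (_ && _) (Edge.tBC _ _)]
  clear hB
  obtain ⟨f, hf, hs⟩ := h
  simp only [Edge.isSide] at hs
  simp only [spl, Edge.tAD, Edge.tBC, Bool.and_eq_true, Bool.or_eq_true, decide_eq_true_eq,
    Edge.valid] at hs hv ⊢
  simp only [mn] at *
  split_ifs at hs with hc <;> rcases hs with rfl | rfl <;> omega

/-- the vertex of the square touches an inner face -/
def Touch (k' k L : ℤ × ℤ → ℤ) (i j : ℤ) (b : Bool) : Prop :=
  (b = false ∧ (k (i, j) < L (i, j) ∨ k (i+1, j) < L (i+1, j))) ∨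
  (spl k' (i, j) = b ∧ (k (i, j+1) < L (i, j+1) ∨ k (i+1, j+1) < L (i+1, j+1))) ∨
  (Edge.tAD k' (i, j) = b ∧ (k (i, j) < L (i, j) ∨ k (i, j+1) < L (i, j+1))) ∨
  (Edge.tBC k' (i, j) = b ∧ (k (i+1, j) < L (i+1, j) ∨ k (i+1, j+1) < L (i+1, j+1)))

theorem lemInj (H : SqFacts k L i j) (ht : Touch k k L i j true) (hf : Touch k k L i j false) :
    spl (mn k L) (i, j) = true := by
  obtain ⟨k1, k2, k3, k4, l1, l2, l3, l4, l5, par⟩ := H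
  simp only [Touch, spl, Edge.tAD, Edge.tBC, Bool.or_eq_true, decide_eq_true_eq,
    Bool.or_eq_false_iff, decide_eq_false_iff_not, reduceCtorEq, Bool.not_eq_true, not_false_eq_true, and_true,
    false_and, true_and, false_or] at ht hf ⊢
  simp only [mn] at *
  omega

set_option maxHeartbeats 4000000 in
theorem lemDiag (H : SqFacts k L i j) (b : Bool) (ht : Touch (mn k L) k L i j b)
    (hv : (Edge.d i j).valid (mn k L)) :
    (Edge.d i j).valid k ∧ ∃ f, k f < L f ∧ (Edge.d i j).isSide k f := by
  obtain ⟨k1, k2, k3, k4, l1, l2, l3, l4, l5, par⟩ := H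
  have key : (Edge.d i j).valid k ∧
      ((k (i+1, j) ≠ k (i, j+1) ∧ (k (i, j) < L (i, j) ∨ k (i+1, j+1) < L (i+1, j+1))) ∨
       (k (i+1, j) = k (i, j+1) ∧ (k (i+1, j) < L (i+1, j) ∨ k (i, j+1) < L (i, j+1)))) := by
    cases b <;>
    simp only [Touch, spl, Edge.tAD, Edge.tBC, Bool.or_eq_true, decide_eq_true_eq,
      Bool.or_eq_false_iff, decide_eq_false_iff_not, reduceCtorEq, Bool.not_eq_true, not_false_eq_true, and_true,
      false_and, true_and, false_or, Edge.valid] at ht hv ⊢ <;>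
    simp only [mn] at * <;>
    rcases l1 with l1 | l1 <;> rcases l2 with l2 | l2 <;> rcases l3 with l3 | l3 <;>
    first | (exfalso; clear ht hv k1 k2 k3 k4 par; omega) | (rcases k1 with k1 | k1 <;> rcases k2 with k2 | k2 <;> rcases k3 with k3 | k3 <;> first | (exfalso; clear ht hv; omega) | omega)
  refine ⟨key.1, ?_⟩
  simp only [Edge.isSide, Edge.tAD, decide_eq_true_eq]
  rcases key.2 with ⟨h, h1 | h1⟩ | ⟨h, h1 | h1⟩
  · exact ⟨_, h1, by simp [h]⟩
  · exact ⟨_, h1, by simp [h]⟩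
  · exact ⟨_, h1, by simp [h]⟩
  · exact ⟨_, h1, by simp [h]⟩

set_option maxHeartbeats 4000000 in
theorem lemNoTouch (H : SqFacts k L i j) (b : Bool) (ht : ¬ Touch (mn k L) k L i j b)
    (hb : b = false ∨ spl (mn k L) (i, j) = b ∨ Edge.tAD (mn k L) (i, j) = b ∨
      Edge.tBC (mn k L) (i, j) = b) :
    (Edge.d i j).valid (mn k L) ∧
      (Edge.tAD (mn k L) (i, j) = b ∨ Edge.tBC (mn k L) (i, j) = b) := by
  obtain ⟨k1, k2, k3, k4, l1, l2, l3, l4, l5, par⟩ := H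
  cases b <;>
  simp only [Touch, spl, Edge.tAD, Edge.tBC, Bool.or_eq_true, decide_eq_true_eq,
      Bool.or_eq_false_iff, decide_eq_false_iff_not, reduceCtorEq, Bool.not_eq_true, not_false_eq_true, and_true,
      false_and, true_and, false_or, Edge.valid] at ht hb ⊢ <;>
  simp only [mn] at * <;>
  rcases l1 with l1 | l1 <;> rcases l2 with l2 | l2 <;> rcases l3 with l3 | l3 <;>
  first | (exfalso; clear ht hb k1 k2 k3 k4 par; omega) | (rcases k1 with k1 | k1 <;> rcases k2 with k2 | k2 <;> rcases k3 with k3 | k3 <;> first | (exfalso; clear ht hb; omega) | omega)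

end local_lemmas

/-- edge set cut out by `k < L` -/
def EE (k L : ℤ × ℤ → ℤ) : Set Edge := {e | e.valid k ∧ ∃ f, k f < L f ∧ e.isSide k f}

theorem EG_eq (i₀ j₀ k₀ : ℤ) (k : ℤ × ℤ → ℤ) : EG i₀ j₀ k₀ k = EE k (coneL i₀ j₀ k₀) := by
  ext e
  simp only [EG, EE, innerF_iff, Set.mem_ofPred_eq]

/-- vertex relabelling -/
def phi (k' : ℤ × ℤ → ℤ) (x : Vtx) : Vtx := (x.1, x.2 && spl k' x.1)

section global_lemmas
variable {k L : ℤ × ℤ → ℤ}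

theorem h_mem_EE {i j : ℤ} : Edge.h i j ∈ EE k L ↔ k (i, j) < L (i, j) ∨ k (i, j+1) < L (i, j+1) := by
  constructor
  · rintro ⟨-, f, hf, rfl | rfl⟩
    · exact Or.inl hf
    · exact Or.inr hf
  · rintro (h | h)
    · exact ⟨trivial, _, h, Or.inl rfl⟩
    · exact ⟨trivial, _, h, Or.inr rfl⟩

theorem v_mem_EE {i j : ℤ} : Edge.v i j ∈ EE k L ↔ k (i, j) < L (i, j) ∨ k (i+1, j) < L (i+1, j) := by
  constructor
  · rintro ⟨-, f, hf, rfl | rfl⟩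
    · exact Or.inl hf
    · exact Or.inr hf
  · rintro (h | h)
    · exact ⟨trivial, _, h, Or.inl rfl⟩
    · exact ⟨trivial, _, h, Or.inr rfl⟩

theorem ends_phi (H : ∀ i j, SqFacts k L i j) (e : Edge) (he : e ∈ EE k L) :
    (e.ends (mn k L)).1 = phi (mn k L) (e.ends k).1 ∧
    (e.ends (mn k L)).2 = phi (mn k L) (e.ends k).2 := by
  cases e with
  | h i j =>
    rw [h_mem_EE] at he
    have h1 := lemE (H (i-1) j) (by simpa using he)
    have h2 := lemW (H i j) he
    simp only [Edge.ends, phi, h1, h2, and_self]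
  | v i j =>
    rw [v_mem_EE] at he
    have h1 := lemN (H i (j-1)) (by simpa using he)
    simp only [spl] at h1
    simp only [Edge.ends, phi, spl, h1, Bool.false_and, and_self]
  | d i j =>
    obtain ⟨h1, h2, -⟩ := lemD (H i j) he.1 he.2
    simp only [Edge.ends, phi, h1, h2, and_self]

theorem touch_of_mem (k' : ℤ × ℤ → ℤ) (H : SqFacts k L i j) (b : Bool) (e : Edge)
    (he : e ∈ EE k L) (hm : Edge.mem k' ((i, j), b) e)
    (hd : ∀ i j, e = Edge.d i j → Edge.tAD k' (i, j) = Edge.tAD k (i, j) ∧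
      Edge.tBC k' (i, j) = Edge.tBC k (i, j)) : Touch k' k L i j b := by
  cases e with
  | h i' j' =>
    rw [h_mem_EE] at he
    rcases hm with hm | hm <;> simp only [Edge.ends, Prod.mk.injEq] at hm <;>
      obtain ⟨⟨rfl, rfl⟩, rfl⟩ := hm
    · exact Or.inr (Or.inr (Or.inr ⟨rfl, by simpa using he⟩))
    · exact Or.inr (Or.inr (Or.inl ⟨rfl, he⟩))
  | v i' j' =>
    rw [v_mem_EE] at he
    rcases hm with hm | hm <;> simp only [Edge.ends, Prod.mk.injEq] at hm <;>
      obtain ⟨⟨rfl, rfl⟩, rfl⟩ := hm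
    · exact Or.inr (Or.inl ⟨rfl, by simpa using he⟩)
    · exact Or.inl ⟨rfl, he⟩
  | d i' j' =>
    obtain ⟨hd1, hd2⟩ := hd _ _ rfl
    obtain ⟨hv, f, hf, hs⟩ := he
    have hb : Edge.tAD k (i, j) = b ∨ Edge.tBC k (i, j) = b := by
      rcases hm with hm | hm <;> simp only [Edge.ends, Prod.mk.injEq] at hm <;>
        obtain ⟨⟨rfl, rfl⟩, rfl⟩ := hm <;> tauto
    obtain ⟨rfl, rfl⟩ : i = i' ∧ j = j' := by
      rcases hm with hm | hm <;> simp only [Edge.ends, Prod.mk.injEq] at hm <;> exact hm.1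
    obtain ⟨k1, k2, k3, k4, -⟩ := H
    simp only [Edge.isSide] at hs
    simp only [Touch, spl, hd1, hd2]
    clear hd hd1 hd2 hm
    cases b <;>
    simp only [Edge.tAD, Edge.tBC, Bool.or_eq_true, decide_eq_true_eq,
      Bool.or_eq_false_iff, decide_eq_false_iff_not, reduceCtorEq, Bool.not_eq_true, not_false_eq_true, and_true,
      false_and, true_and, false_or, Edge.valid] at hv hs hb ⊢ <;>
    split_ifs at hs with hc <;> rcases hs with rfl | rfl <;> omega

theorem diag_eq (H : ∀ i j, SqFacts k L i j) {i j : ℤ} (he : Edge.d i j ∈ EE k L) :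
    Edge.tAD (mn k L) (i, j) = Edge.tAD k (i, j) ∧
      Edge.tBC (mn k L) (i, j) = Edge.tBC k (i, j) := by
  obtain ⟨h1, h2, h3⟩ := lemD (H i j) he.1 he.2
  have : spl (mn k L) (i, j) = true := by
    simp only [Edge.valid] at h3
    simp only [spl, Edge.tAD, Edge.tBC, Bool.or_eq_true, decide_eq_true_eq]
    tauto
  rw [this, Bool.and_true] at h1 h2
  exact ⟨h1.symm, h2.symm⟩

theorem phi_inj (H : ∀ i j, SqFacts k L i j) {x y : Vtx} (hx : x ∈ VG k (EE k L))
    (hy : y ∈ VG k (EE k L)) (h : phi (mn k L) x = phi (mn k L) y) : x = y := by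
  obtain ⟨⟨i, j⟩, b⟩ := x
  obtain ⟨⟨i', j'⟩, b'⟩ := y
  simp only [phi, Prod.mk.injEq] at h
  obtain ⟨⟨rfl, rfl⟩, h⟩ := h
  obtain ⟨e, he, hm⟩ := hx
  obtain ⟨e', he', hm'⟩ := hy
  have t1 := touch_of_mem k (H _ _) b e he hm (fun _ _ _ => ⟨rfl, rfl⟩)
  have t2 := touch_of_mem k (H _ _) b' e' he' hm' (fun _ _ _ => ⟨rfl, rfl⟩)
  cases b <;> cases b'
  · rfl
  · simp [lemInj (H _ _) t2 t1] at h
  · simp [lemInj (H _ _) t1 t2] at h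
  · rfl

theorem mem_phi (H : ∀ i j, SqFacts k L i j) {x : Vtx} (hx : x ∈ VG k (EE k L)) {e : Edge}
    (he : e ∈ EE k L) : Edge.mem (mn k L) (phi (mn k L) x) e ↔ Edge.mem k x e := by
  obtain ⟨h1, h2⟩ := ends_phi H e he
  simp only [Edge.mem, h1, h2]
  constructor
  · rintro (h | h)
    · exact Or.inl (phi_inj H hx ⟨e, he, Or.inl rfl⟩ h)
    · exact Or.inr (phi_inj H hx ⟨e, he, Or.inr rfl⟩ h)
  · rintro (h | h)
    · exact Or.inl (h ▸ rfl)
    · exact Or.inr (h ▸ rfl)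

/-- the added diagonals -/
def DD (k L : ℤ × ℤ → ℤ) : Set Edge :=
  {e | e ∈ {e : Edge | e.valid (mn k L)} ∧ e ∉ EE k L ∧ e.isDiag}

theorem EE_sub (H : ∀ i j, SqFacts k L i j) : EE k L ⊆ {e : Edge | e.valid (mn k L)} := by
  intro e he
  cases e with
  | h i j => trivial
  | v i j => trivial
  | d i j => exact (lemD (H i j) he.1 he.2).2.2

theorem not_DD (H : ∀ i j, SqFacts k L i j) {y : Vtx} (hy : y ∈ VG (mn k L) (EE k L)) {e : Edge}
    (he : e ∈ DD k L) : ¬ Edge.mem (mn k L) y e := by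
  intro hm
  obtain ⟨⟨i, j⟩, b⟩ := y
  obtain ⟨e', he', hm'⟩ := hy
  have t := touch_of_mem (mn k L) (H i j) b e' he' hm' (fun i j h => diag_eq H (h ▸ he'))
  obtain ⟨hv, hn, hd⟩ := he
  cases e with
  | h i j => exact hd
  | v i j => exact hd
  | d i' j' =>
    obtain ⟨rfl, rfl⟩ : i = i' ∧ j = j' := by
      rcases hm with hm | hm <;> simp only [Edge.ends, Prod.mk.injEq] at hm <;> exact hm.1
    exact hn (lemDiag (H i j) b t hv)

theorem mem_of_touch (k' : ℤ × ℤ → ℤ) (i j : ℤ) (b : Bool) (ht : Touch k' k L i j b) :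
    ((i, j), b) ∈ VG k' (EE k L) := by
  rcases ht with ⟨rfl, h⟩ | ⟨rfl, h⟩ | ⟨rfl, h⟩ | ⟨rfl, h⟩
  · exact ⟨Edge.v i j, v_mem_EE.2 h, Or.inr rfl⟩
  · exact ⟨Edge.v i (j+1), v_mem_EE.2 h, Or.inl (by simp [Edge.ends, spl])⟩
  · exact ⟨Edge.h i j, h_mem_EE.2 h, Or.inr rfl⟩
  · exact ⟨Edge.h (i+1) j, h_mem_EE.2 h, Or.inl (by simp [Edge.ends])⟩

theorem ex_DD (H : ∀ i j, SqFacts k L i j) {y : Vtx}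
    (hy : y ∈ VG (mn k L) {e : Edge | e.valid (mn k L)}) (hn : y ∉ VG (mn k L) (EE k L)) :
    ∃! e, e ∈ DD k L ∧ Edge.mem (mn k L) y e := by
  obtain ⟨⟨i, j⟩, b⟩ := y
  have hb : b = false ∨ spl (mn k L) (i, j) = b ∨ Edge.tAD (mn k L) (i, j) = b ∨
      Edge.tBC (mn k L) (i, j) = b := by
    obtain ⟨e, -, hm⟩ := hy
    cases e <;> rcases hm with hm | hm <;> simp only [Edge.ends, Prod.mk.injEq] at hm <;>
        obtain ⟨⟨rfl, rfl⟩, rfl⟩ := hm <;> simp [spl]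
  obtain ⟨hv, hb'⟩ := lemNoTouch (H i j) b (fun ht => hn (mem_of_touch _ i j b ht)) hb
  have hm : Edge.mem (mn k L) ((i, j), b) (Edge.d i j) := by
    rcases hb' with h | h
    · exact Or.inl (by rw [← h]; rfl)
    · exact Or.inr (by rw [← h]; rfl)
  refine ⟨Edge.d i j, ⟨⟨hv, fun he => hn ⟨_, he, hm⟩, trivial⟩, hm⟩, ?_⟩
  rintro e ⟨⟨-, -, hd⟩, hm'⟩
  cases e with
  | h i j => exact hd.elim
  | v i j => exact hd.elim
  | d i' j' =>
    obtain ⟨rfl, rfl⟩ : i = i' ∧ j = j' := by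
      rcases hm' with hm | hm <;> simp only [Edge.ends, Prod.mk.injEq] at hm <;> exact hm.1
    rfl

theorem pm_iff (H : ∀ i j, SqFacts k L i j) (M : Set Edge) (hM : M ⊆ EE k L) :
    IsPerfectMatching k (EE k L) M ↔
      IsPerfectMatching (mn k L) {e : Edge | e.valid (mn k L)} (M ∪ DD k L) := by
  have key : ∀ x ∈ VG k (EE k L), ∀ e, (e ∈ M ∪ DD k L ∧ Edge.mem (mn k L) (phi (mn k L) x) e) ↔
      (e ∈ M ∧ Edge.mem k x e) := by
    intro x hx e
    have hx' : phi (mn k L) x ∈ VG (mn k L) (EE k L) := by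
      obtain ⟨e', he', hm'⟩ := id hx
      exact ⟨e', he', (mem_phi H hx he').2 hm'⟩
    constructor
    · rintro ⟨he | he, hm⟩
      · exact ⟨he, (mem_phi H hx (hM he)).1 hm⟩
      · exact (not_DD H hx' he hm).elim
    · rintro ⟨he, hm⟩
      exact ⟨Or.inl he, (mem_phi H hx (hM he)).2 hm⟩
  constructor
  · rintro ⟨-, hp⟩
    refine ⟨Set.union_subset (hM.trans (EE_sub H)) (fun e he => he.1), ?_⟩
    intro y hy
    by_cases hyE : y ∈ VG (mn k L) (EE k L)
    · obtain ⟨x, hx, rfl⟩ : ∃ x ∈ VG k (EE k L), phi (mn k L) x = y := by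
        obtain ⟨e, he, hm⟩ := hyE
        obtain ⟨h1, h2⟩ := ends_phi H e he
        rcases hm with hm | hm
        · exact ⟨_, ⟨e, he, Or.inl rfl⟩, by rw [hm, h1]⟩
        · exact ⟨_, ⟨e, he, Or.inr rfl⟩, by rw [hm, h2]⟩
      simp only [key x hx]
      exact hp x hx
    · obtain ⟨e, ⟨he, hm⟩, hu⟩ := ex_DD H hy hyE
      refine ⟨e, ⟨Or.inr he, hm⟩, ?_⟩
      rintro e' ⟨he' | he', hm'⟩
      · exact (hyE ⟨e', hM he', hm'⟩).elim
      · exact hu e' ⟨he', hm'⟩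
  · rintro ⟨-, hp⟩
    refine ⟨hM, fun x hx => ?_⟩
    have hx' : phi (mn k L) x ∈ VG (mn k L) {e : Edge | e.valid (mn k L)} := by
      obtain ⟨e', he', hm'⟩ := id hx
      exact ⟨e', EE_sub H he', (mem_phi H hx he').2 hm'⟩
    have := hp _ hx'
    simpa only [key x hx] using this

end global_lemmas

/-- **Infinite completion bijection** (Proposition `prop:infcomp`): the map
`M ↦ M ∪ {diagonal edges of E(G_∞) \ E(G)}` is a bijection from the set of perfect
matchings of `G` onto the set of acceptable perfect matchings of `G_∞ = G_{k_p}`. -/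
theorem infinite_completion_bijection
    (i₀ j₀ k₀ : ℤ) (k : ℤ × ℤ → ℤ)
    (hstep : SteppedSurface k)
    (hodd : Odd (i₀ + j₀ + k₀))
    (hoddk : ∀ f : ℤ × ℤ, Odd (f.1 + f.2 + k f))
    (hk0 : k (i₀, j₀) ≤ k₀)
    (hfund : ∀ f : ℤ × ℤ, fund f ≤ k f)
    :
    Set.BijOn
      (fun M => M ∪ {e | e ∈ Einf i₀ j₀ k₀ k ∧ e ∉ EG i₀ j₀ k₀ k ∧ e.isDiag})
      {M | IsPerfectMatching k (EG i₀ j₀ k₀ k) M}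
      (Acceptable i₀ j₀ k₀ k) := by
  have H : ∀ i j, SqFacts k (coneL i₀ j₀ k₀) i j := sqFacts i₀ j₀ k₀ k hstep hodd hoddk
  simp only [Acceptable, Einf, EG_eq, kAdj_eq]
  change Set.BijOn (fun M => M ∪ DD k (coneL i₀ j₀ k₀)) _
    {M | IsPerfectMatching _ _ M ∧ M \ _ = DD k (coneL i₀ j₀ k₀)}
  have hdisj : ∀ e ∈ DD k (coneL i₀ j₀ k₀), e ∉ EE k (coneL i₀ j₀ k₀) := fun e he => he.2.1
  refine ⟨?_, ?_, ?_⟩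
  · intro M hM
    refine ⟨(pm_iff H M hM.1).1 hM, ?_⟩
    ext e
    have h1 := @hM.1 e
    have h2 := hdisj e
    simp only [Set.mem_sdiff, Set.mem_union]
    tauto
  · intro M hM N hN h
    ext e
    have h1 := @hM.1 e
    have h2 := @hN.1 e
    have h3 := hdisj e
    have h4 : e ∈ M ∪ DD k (coneL i₀ j₀ k₀) ↔ e ∈ N ∪ DD k (coneL i₀ j₀ k₀) := by
      simp only at h
      rw [h]
    simp only [Set.mem_union] at h4
    tauto
  · rintro N ⟨hN, hD⟩
    have hu : (N ∩ EE k (coneL i₀ j₀ k₀)) ∪ DD k (coneL i₀ j₀ k₀) = N := by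
      rw [← hD]
      exact Set.inter_union_sdiff N _
    refine ⟨N ∩ EE k (coneL i₀ j₀ k₀), ?_, hu⟩
    refine (pm_iff H _ Set.inter_subset_right).2 ?_
    rw [hu]
    exact hN

end OctahedronTSystem
end
end
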